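/- Fix an integer N ≥ 2 and reals Γ > 0, N₀ > 0. Let M_i = 2^{k_i} and M_j = 2^{k_j} with k_i ≠ k_j nonnegative integers. Then the functions g_{M_i} and g_{M_j} on ℂ^N are not identical (there exists r ∈ ℂ^N with g_{M_i}(r) ≠ g_{M_j}(r)); consequently the probability measures Q_{M_i} and Q_{M_j} on ℂ^N with densities (πN₀)^{−N}·g_{M_i} and (πN₀)^{−N}·g_{M_j} are distinct and klDiv(Q_{M_i}, Q_{M_j}) > 0. (Lemma 2, PSK-versus-PSK case: for N > 1 the ALRT averaged likelihoods of two different PSK orders are at positive KL distance.) -/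

import Mathlib

open Real MeasureTheory ProbabilityTheory Filter

/-- Sum of pairwise cosines `Σ_{k<h} cos(2π(m_h − m_k)/M)` of a symbol index sequence. -/
noncomputable def pairCosSum (M N : ℕ) (m : Fin N → Fin M) : ℝ :=
  ∑ p ∈ Finset.univ.filter (fun p : Fin N × Fin N => p.1 < p.2),
    Real.cos (2 * π * (((m p.2 : ℕ) : ℝ) - ((m p.1 : ℕ) : ℝ)) / (M : ℝ))

/-- The ALRT averaged likelihood (up to the constant `(πN₀)^{−N}`) of `N` samples of `M`-PSK
under Rayleigh amplitude with `E[a²] = Γ`, uniform phase, and known noise power `N₀`. -/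
noncomputable def alrtLik (Γ N₀ : ℝ) (N M : ℕ) (r : Fin N → ℂ) : ℝ :=
  ((M : ℝ) ^ N)⁻¹ * ∑ m : Fin N → Fin M, (1 + N * Γ / N₀)⁻¹ *
    Real.exp ((Γ / N₀ ^ 2) *
        (norm (∑ k, Complex.exp
            (-(2 * (π : ℂ) * Complex.I * ((m k : ℕ) : ℂ) / (M : ℂ))) * r k)) ^ 2
          / (1 + N * Γ / N₀)
      - (∑ k, (norm (r k)) ^ 2) / N₀)

/-- The probability measure on `ℂ^N` whose density w.r.t. Lebesgue measure is
`(πN₀)^{−N} · alrtLik Γ N₀ N M`. -/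
noncomputable def alrtMeasure (Γ N₀ : ℝ) (N M : ℕ) : Measure (Fin N → ℂ) :=
  volume.withDensity fun r => ENNReal.ofReal (((π * N₀) ^ N)⁻¹ * alrtLik Γ N₀ N M r)

/-- Kullback–Leibler divergence `∫ log (dP/dQ) dP` of measures (`⊤` if `P` is not absolutely
continuous w.r.t. `Q` or the log-likelihood ratio is not integrable). -/
noncomputable def klDiv {α : Type*} [MeasurableSpace α] (P Q : Measure α) : EReal := by
  classical
  exact if P ≪ Q ∧ Integrable (llr P Q) P then ((∫ x, llr P Q x ∂P : ℝ) : EReal) else ⊤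

noncomputable def pskRot (M : ℕ) (j : Fin M) : ℂ :=
  Complex.exp (-(2 * (π : ℂ) * Complex.I * ((j : ℕ) : ℂ) / (M : ℂ)))

lemma pskRot_eq_circle (M : ℕ) (j : Fin M) :
    pskRot M j = (Circle.exp (-(2 * π * (j : ℕ) / M)) : ℂ) := by
  rw [Circle.coe_exp, pskRot]
  congr 1
  push_cast
  ring

lemma norm_pskRot (M : ℕ) (j : Fin M) : ‖pskRot M j‖ = 1 := by
  rw [pskRot_eq_circle]; exact Circle.norm_coe _

lemma pskRot_inj (M : ℕ) (i j : Fin M) (h : pskRot M i = pskRot M j) : i = j := by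
  unfold pskRot at h
  rw [Complex.exp_eq_exp_iff_exists_int] at h
  obtain ⟨n, hn⟩ := h
  have hM : 0 < M := i.pos
  have hM' : (M : ℂ) ≠ 0 := by exact_mod_cast hM.ne'
  have h2 : (2 * (π : ℂ) * Complex.I) ≠ 0 := Complex.two_pi_I_ne_zero
  have h3 : (2 * (π : ℂ) * Complex.I) * (((j : ℕ) : ℂ) - ((i : ℕ) : ℂ) - n * M) = 0 := by
    field_simp at hn
    linear_combination (2 * (π : ℂ) * Complex.I) * hn
  have h4 : ((j : ℕ) : ℂ) - ((i : ℕ) : ℂ) - n * M = 0 := by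
    rcases mul_eq_zero.1 h3 with h | h
    · exact absurd h h2
    · exact h
  have h5 : ((j : ℕ) : ℤ) - ((i : ℕ) : ℤ) = n * M := by
    have : (((j : ℕ) : ℤ) - ((i : ℕ) : ℤ) - n * M : ℤ) = 0 := by exact_mod_cast h4
    linarith
  have hi := i.2
  have hj := j.2
  have : n = 0 := by
    have a : n < 1 := by
      by_contra! hc
      nlinarith
    have b : -1 < n := by
      by_contra! hc
      nlinarith
    omega
  subst this
  apply Fin.ext
  omega

/-- The norm of a sum of rotations is `N` for constant sequences and less otherwise. -/
lemma norm_sum_pskRot_const (N M : ℕ) (j : Fin M) : ‖∑ _k : Fin N, pskRot M j‖ = N := by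
  simp [norm_pskRot]

lemma norm_sum_pskRot_lt (N M : ℕ) (m : Fin N → Fin M) (a b : Fin N) (hab : m a ≠ m b) :
    ‖∑ k, pskRot M (m k)‖ < N := by
  have hne : a ≠ b := fun h => hab (by rw [h])
  have h1 : ‖pskRot M (m a) + pskRot M (m b)‖ < 2 := by
    have := norm_add_lt_of_not_sameRay (x := pskRot M (m a)) (y := pskRot M (m b))
      (by
        rw [sameRay_iff_of_norm_eq (by simp [norm_pskRot])]
        exact fun h => hab (pskRot_inj _ _ _ h))
    rw [norm_pskRot, norm_pskRot] at this
    linarith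
  have hb : b ∈ Finset.univ.erase a := by simp [hne.symm]
  rw [← Finset.add_sum_erase _ _ (Finset.mem_univ a), ← Finset.add_sum_erase _ _ hb, ← add_assoc]
  have h2 : ‖∑ k ∈ (Finset.univ.erase a).erase b, pskRot M (m k)‖ ≤ (N : ℝ) - 2 := by
    refine (norm_sum_le _ _).trans ?_
    simp only [norm_pskRot, Finset.sum_const, nsmul_eq_mul, mul_one]
    rw [Finset.card_erase_of_mem hb, Finset.card_erase_of_mem (Finset.mem_univ a)]
    have : 2 ≤ N := by
      have := a.2; have := b.2; have : (a : ℕ) ≠ b := fun h => hne (Fin.ext h)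
      omega
    simp only [Finset.card_univ, Fintype.card_fin]
    rw [Nat.sub_sub, Nat.cast_sub this]
    norm_num
  exact (norm_add_le _ _).trans_lt (by linarith)

lemma alrtLik_limit (Γ N₀ : ℝ) (hΓ : 0 < Γ) (hN₀ : 0 < N₀) (N M : ℕ) (hN : 0 < N) :
    Tendsto (fun t : ℝ => (1 + N * Γ / N₀) * Real.exp (-((Γ / N₀ ^ 2) * (N * t) ^ 2 / (1 + N * Γ / N₀)
      - N * t ^ 2 / N₀)) * alrtLik Γ N₀ N M (fun _ => (t : ℂ))) atTop
      (nhds (((M : ℝ) ^ N)⁻¹ * M)) := by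
  have hD : 0 < 1 + N * Γ / N₀ := by positivity
  have hc : 0 < (Γ / N₀ ^ 2) / (1 + N * Γ / N₀) := by positivity
  have key : ∀ t : ℝ, (1 + N * Γ / N₀) * Real.exp (-((Γ / N₀ ^ 2) * (N * t) ^ 2 / (1 + N * Γ / N₀)
      - N * t ^ 2 / N₀)) * alrtLik Γ N₀ N M (fun _ => (t : ℂ)) =
      ((M : ℝ) ^ N)⁻¹ * ∑ m : Fin N → Fin M, Real.exp
        ((Γ / N₀ ^ 2) / (1 + N * Γ / N₀) * (‖∑ k, pskRot M (m k)‖ ^ 2 - N ^ 2) * t ^ 2) := by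
    intro t
    unfold alrtLik
    rw [mul_left_comm, Finset.mul_sum]
    congr 1
    refine Finset.sum_congr rfl fun m _ => ?_
    rw [mul_mul_mul_comm, mul_inv_cancel₀ hD.ne', one_mul, ← Real.exp_add]
    congr 1
    change _ + ((Γ / N₀ ^ 2) * ‖∑ k, pskRot M (m k) * (t : ℂ)‖ ^ 2 / _ - _) = _
    rw [← Finset.sum_mul, norm_mul, Complex.norm_real, Real.norm_eq_abs, mul_pow _ |t|, sq_abs]
    simp only [Complex.norm_real, Real.norm_eq_abs, sq_abs, Finset.sum_const, Finset.card_univ,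
      Fintype.card_fin, nsmul_eq_mul]
    ring
  simp_rw [key]
  have hcard : (M : ℝ) = ∑ m : Fin N → Fin M, if (∃ j, m = fun _ => j) then (1 : ℝ) else 0 := by
    classical
    rw [Finset.sum_boole]
    have : (Finset.univ.filter fun m : Fin N → Fin M => ∃ j, m = fun _ => j) =
        Finset.univ.image (fun j : Fin M => fun _ : Fin N => j) := by
      ext m; simp [eq_comm]
    have hinj : Function.Injective (fun j : Fin M => fun _ : Fin N => j) := by
      intro i j h
      exact congrFun h ⟨0, hN⟩
    have h2 := Finset.card_image_of_injective (Finset.univ : Finset (Fin M)) hinj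
    rw [← this] at h2
    simp only [Finset.card_univ, Fintype.card_fin] at h2
    norm_cast
    convert h2.symm
  refine Tendsto.const_mul _ ?_
  conv => rhs; rw [hcard]
  refine tendsto_finsetSum _ fun m _ => ?_
  split_ifs with h
  · obtain ⟨j, rfl⟩ := h
    simp [norm_pskRot]
  · have hlt : ‖∑ k, pskRot M (m k)‖ < N := by
      by_contra hc
      apply h
      refine ⟨m ⟨0, hN⟩, funext fun k => ?_⟩
      by_contra hk
      exact hc (norm_sum_pskRot_lt N M m _ _ hk)
    have h0 := norm_nonneg (∑ k, pskRot M (m k))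
    have hneg : (Γ / N₀ ^ 2) / (1 + N * Γ / N₀) * (‖∑ k, pskRot M (m k)‖ ^ 2 - N ^ 2) < 0 := by
      apply mul_neg_of_pos_of_neg hc
      nlinarith
    refine Real.tendsto_exp_atBot.comp ?_
    exact (tendsto_pow_atTop two_ne_zero).const_mul_atTop_of_neg hneg

lemma alrtLik_ne (N : ℕ) (hN : 2 ≤ N) (Γ N₀ : ℝ) (hΓ : 0 < Γ) (hN₀ : 0 < N₀)
    (ki kj : ℕ) (hk : ki ≠ kj) :
    ∃ r : Fin N → ℂ, alrtLik Γ N₀ N (2 ^ ki) r ≠ alrtLik Γ N₀ N (2 ^ kj) r := by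
  by_contra! h
  have h1 := alrtLik_limit Γ N₀ hΓ hN₀ N (2 ^ ki) (by omega)
  have h2 := alrtLik_limit Γ N₀ hΓ hN₀ N (2 ^ kj) (by omega)
  simp_rw [h] at h1
  have h3 := tendsto_nhds_unique h1 h2
  obtain ⟨n, rfl⟩ : ∃ n, N = n + 2 := ⟨N - 2, by omega⟩
  have e : ∀ M : ℕ, 0 < M → ((M : ℝ) ^ (n + 2))⁻¹ * M = ((M : ℝ) ^ (n + 1))⁻¹ := by
    intro M hM
    have : (M : ℝ) ≠ 0 := by positivity
    field_simp
    ring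
  rw [e _ (by positivity), e _ (by positivity), inv_inj] at h3
  have h4 : (2 ^ ki) ^ (n + 1) = (2 ^ kj) ^ (n + 1) := by exact_mod_cast h3
  have h5 := Nat.pow_left_injective (n := n + 1) (by omega) h4
  exact hk (Nat.pow_right_injective le_rfl h5)

/-- The unrotated Gaussian kernel. -/
noncomputable def pskKer (Γ N₀ : ℝ) (N : ℕ) (r : Fin N → ℂ) : ℝ :=
  Real.exp ((Γ / N₀ ^ 2) * ‖∑ k, r k‖ ^ 2 / (1 + N * Γ / N₀) - (∑ k, ‖r k‖ ^ 2) / N₀)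

lemma alrtLik_eq (Γ N₀ : ℝ) (N M : ℕ) (r : Fin N → ℂ) :
    alrtLik Γ N₀ N M r = ((M : ℝ) ^ N)⁻¹ * ∑ m : Fin N → Fin M, (1 + N * Γ / N₀)⁻¹ *
      pskKer Γ N₀ N (fun k => pskRot M (m k) * r k) := by
  unfold alrtLik pskKer
  simp only [norm_mul, norm_pskRot, one_mul]
  rfl

lemma continuous_pskKer (Γ N₀ : ℝ) (N : ℕ) : Continuous (pskKer Γ N₀ N) := by
  unfold pskKer
  fun_prop

lemma continuous_alrtLik (Γ N₀ : ℝ) (N M : ℕ) : Continuous (alrtLik Γ N₀ N M) := by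
  unfold alrtLik
  fun_prop

lemma alrtLik_nonneg (Γ N₀ : ℝ) (hΓ : 0 < Γ) (hN₀ : 0 < N₀) (N M : ℕ) (r : Fin N → ℂ) :
    0 ≤ alrtLik Γ N₀ N M r := by
  unfold alrtLik
  positivity

lemma integrable_gauss (N : ℕ) (b : ℝ) (hb : 0 < b) :
    Integrable (fun r : Fin N → ℂ => Real.exp (-(b * ∑ k, ‖r k‖ ^ 2))) := by
  have h1 : Integrable (fun z : ℂ => Real.exp (-(b * ‖z‖ ^ 2))) := by
    have := (GaussianFourier.integrable_cexp_neg_mul_sq_norm_add (V := ℂ) (b := (b : ℂ))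
      (by simpa using hb) 0 0).norm
    refine this.congr (Eventually.of_forall fun z => ?_)
    simp only [Complex.norm_exp]
    congr 1
    norm_cast
    simp
  have h2 := Integrable.fintype_prod (ι := Fin N) (fun _ => h1)
  refine h2.congr (Eventually.of_forall fun r => ?_)
  simp only
  rw [← Real.exp_sum, Finset.mul_sum, Finset.sum_neg_distrib]

lemma integrable_pskKer (Γ N₀ : ℝ) (hΓ : 0 < Γ) (hN₀ : 0 < N₀) (N : ℕ) :
    Integrable (pskKer Γ N₀ N) := by
  have hD : 0 < 1 + N * Γ / N₀ := by positivity
  refine (integrable_gauss N (1 / (N₀ * (1 + N * Γ / N₀))) (by positivity)).mono'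
    (continuous_pskKer Γ N₀ N).aestronglyMeasurable (Eventually.of_forall fun r => ?_)
  unfold pskKer
  rw [Real.norm_eq_abs, Real.abs_exp, Real.exp_le_exp]
  have h1 : ‖∑ k, r k‖ ^ 2 ≤ N * ∑ k, ‖r k‖ ^ 2 := by
    calc ‖∑ k, r k‖ ^ 2 ≤ (∑ k, ‖r k‖) ^ 2 := by gcongr; exact norm_sum_le _ _
      _ ≤ _ := by simpa using sq_sum_le_card_mul_sum_sq (s := Finset.univ) (f := fun k => ‖r k‖)
  set S := ∑ k, ‖r k‖ ^ 2
  calc _ ≤ (Γ / N₀ ^ 2) * (N * S) / (1 + N * Γ / N₀) - S / N₀ := by gcongr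
    _ = _ := by
      have hD' : N₀ + N * Γ ≠ 0 := by positivity
      have : (1 + N * Γ / N₀) = (N₀ + N * Γ) / N₀ := by field_simp
      rw [this]
      field_simp
      ring

lemma mp_pskRot (N M : ℕ) (m : Fin N → Fin M) :
    MeasurePreserving (fun (r : Fin N → ℂ) k => pskRot M (m k) * r k) volume volume := by
  have := volume_preserving_pi (ι := Fin N) (α' := fun _ => ℂ) (β' := fun _ => ℂ)
    (f := fun k => rotation (Circle.exp (-(2 * π * (m k : ℕ) / M))))
    (fun k => LinearIsometryEquiv.measurePreserving _)
  simp only [rotation_apply, ← pskRot_eq_circle] at this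
  exact this

lemma integrable_alrtLik (Γ N₀ : ℝ) (hΓ : 0 < Γ) (hN₀ : 0 < N₀) (N M : ℕ) :
    Integrable (alrtLik Γ N₀ N M) := by
  simp_rw [funext (alrtLik_eq Γ N₀ N M)]
  refine Integrable.const_mul (integrable_finsetSum _ fun m _ => Integrable.const_mul ?_ _) _
  exact (mp_pskRot N M m).integrable_comp_of_integrable (integrable_pskKer Γ N₀ hΓ hN₀ N)

lemma integral_alrtLik (Γ N₀ : ℝ) (hΓ : 0 < Γ) (hN₀ : 0 < N₀) (N M : ℕ) (hM : 0 < M) :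
    ∫ r, alrtLik Γ N₀ N M r = (1 + N * Γ / N₀)⁻¹ * ∫ r, pskKer Γ N₀ N r := by
  simp_rw [funext (alrtLik_eq Γ N₀ N M)]
  rw [integral_const_mul, integral_finsetSum]
  · have : ∀ m : Fin N → Fin M, ∫ r : Fin N → ℂ, (1 + N * Γ / N₀)⁻¹ *
        pskKer Γ N₀ N (fun k => pskRot M (m k) * r k) =
        (1 + N * Γ / N₀)⁻¹ * ∫ r, pskKer Γ N₀ N r := by
      intro m
      rw [integral_const_mul]
      congr 1
      have h := integral_map (mp_pskRot N M m).aemeasurable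
        (f := pskKer Γ N₀ N) (continuous_pskKer Γ N₀ N).aestronglyMeasurable
      rw [(mp_pskRot N M m).map_eq] at h
      exact h.symm
    simp_rw [this]
    have hM' : (M : ℝ) ≠ 0 := by positivity
    simp [hM']
  · intro m _
    refine Integrable.const_mul ?_ _
    exact (mp_pskRot N M m).integrable_comp_of_integrable (integrable_pskKer Γ N₀ hΓ hN₀ N)

lemma isFinite_alrtMeasure (Γ N₀ : ℝ) (hΓ : 0 < Γ) (hN₀ : 0 < N₀) (N M : ℕ) :
    IsFiniteMeasure (alrtMeasure Γ N₀ N M) :=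
  isFiniteMeasure_withDensity_ofReal ((integrable_alrtLik Γ N₀ hΓ hN₀ N M).const_mul _).2

lemma alrtMeasure_univ (Γ N₀ : ℝ) (hΓ : 0 < Γ) (hN₀ : 0 < N₀) (N M : ℕ) (hM : 0 < M) :
    alrtMeasure Γ N₀ N M Set.univ = ENNReal.ofReal (((π * N₀) ^ N)⁻¹ *
      ((1 + N * Γ / N₀)⁻¹ * ∫ r, pskKer Γ N₀ N r)) := by
  unfold alrtMeasure
  rw [withDensity_apply _ MeasurableSet.univ, Measure.restrict_univ,
    ← ofReal_integral_eq_lintegral_ofReal ((integrable_alrtLik Γ N₀ hΓ hN₀ N M).const_mul _),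
    integral_const_mul, integral_alrtLik Γ N₀ hΓ hN₀ N M hM]
  refine Eventually.of_forall fun r => ?_
  have := alrtLik_nonneg Γ N₀ hΓ hN₀ N M r
  simp only [Pi.zero_apply]
  positivity

lemma alrtMeasure_ne (N : ℕ) (hN : 2 ≤ N) (Γ N₀ : ℝ) (hΓ : 0 < Γ) (hN₀ : 0 < N₀)
    (ki kj : ℕ) (hk : ki ≠ kj) :
    alrtMeasure Γ N₀ N (2 ^ ki) ≠ alrtMeasure Γ N₀ N (2 ^ kj) := by
  intro h
  unfold alrtMeasure at h
  have hc : ∀ M, Continuous (fun r : Fin N → ℂ =>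
      ENNReal.ofReal (((π * N₀) ^ N)⁻¹ * alrtLik Γ N₀ N M r)) := fun M =>
    ENNReal.continuous_ofReal.comp (continuous_const.mul (continuous_alrtLik Γ N₀ N M))
  rw [withDensity_eq_iff_of_sigmaFinite (hc _).aemeasurable (hc _).aemeasurable,
    Continuous.ae_eq_iff_eq _ (hc _) (hc _)] at h
  obtain ⟨r, hr⟩ := alrtLik_ne N hN Γ N₀ hΓ hN₀ ki kj hk
  have h1 := congrFun h r
  have hp : 0 < ((π * N₀) ^ N)⁻¹ := by positivity
  have n1 := alrtLik_nonneg Γ N₀ hΓ hN₀ N (2 ^ ki) r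
  have n2 := alrtLik_nonneg Γ N₀ hΓ hN₀ N (2 ^ kj) r
  rw [ENNReal.ofReal_eq_ofReal_iff (by positivity) (by positivity)] at h1
  exact hr (mul_left_cancel₀ hp.ne' h1)

/-- **Lemma 2, PSK-vs-PSK case.** For `N ≥ 2` observations, the ALRT averaged
likelihoods of two different power-of-two PSK orders differ, the corresponding probability
measures are distinct, and their KL distance is positive. -/
theorem alrt_psk_psk_distinct (N : ℕ) (hN : 2 ≤ N) (Γ N₀ : ℝ) (hΓ : 0 < Γ) (hN₀ : 0 < N₀)
    (ki kj : ℕ) (hk : ki ≠ kj) :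
    (∃ r : Fin N → ℂ, alrtLik Γ N₀ N (2 ^ ki) r ≠ alrtLik Γ N₀ N (2 ^ kj) r) ∧
      alrtMeasure Γ N₀ N (2 ^ ki) ≠ alrtMeasure Γ N₀ N (2 ^ kj) ∧
      0 < klDiv (alrtMeasure Γ N₀ N (2 ^ ki)) (alrtMeasure Γ N₀ N (2 ^ kj)) := by
  refine ⟨alrtLik_ne N hN Γ N₀ hΓ hN₀ ki kj hk, alrtMeasure_ne N hN Γ N₀ hΓ hN₀ ki kj hk, ?_⟩
  have := isFinite_alrtMeasure Γ N₀ hΓ hN₀ N (2 ^ ki)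
  have := isFinite_alrtMeasure Γ N₀ hΓ hN₀ N (2 ^ kj)
  have hu : alrtMeasure Γ N₀ N (2 ^ ki) Set.univ = alrtMeasure Γ N₀ N (2 ^ kj) Set.univ := by
    rw [alrtMeasure_univ Γ N₀ hΓ hN₀ N _ (by positivity),
      alrtMeasure_univ Γ N₀ hΓ hN₀ N _ (by positivity)]
  unfold klDiv
  split_ifs with h
  · rw [← InformationTheory.toReal_klDiv_of_measure_eq h.1 hu]
    have h1 := InformationTheory.klDiv_ne_top h.1 h.2
    have h0 : InformationTheory.klDiv (alrtMeasure Γ N₀ N (2 ^ ki))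
        (alrtMeasure Γ N₀ N (2 ^ kj)) ≠ 0 := fun h0 =>
      alrtMeasure_ne N hN Γ N₀ hΓ hN₀ ki kj hk (InformationTheory.klDiv_eq_zero_iff.1 h0)
    exact_mod_cast ENNReal.toReal_pos h0 h1
  · exact EReal.zero_lt_top
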